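/- For all integers n ≥ 2, m ≥ 1 and k ≥ 0, Σ_{i=n+m−1}^{n+m+k−1} D(n−1, m, i−n−m+1)·D(1, i, n+m+k−1−i) = Σ_{j=n}^{n+k} D(1, n−1, j−n)·D(j, m, n+k−j). -/

import Mathlib

open Finset

/-- The closed-form ordinary `K`-theory structure constant `D n m k = d^{n+m+k}_{n,m}(1)`. -/
noncomputable def D (n m k : ℕ) : ℚ :=
  (-1) ^ k * ((n + m + k - 1).factorial : ℚ) /
      (((n - 1).factorial : ℚ) * ((m - 1).factorial : ℚ) * (k.factorial : ℚ)) *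
      (((n : ℚ) + m + 2 * k) / (((n : ℚ) + k) * ((m : ℚ) + k)))

/-- The part of the associativity summands that gets reflected between the two sides. -/
noncomputable def reflectedPart (a m t r : ℕ) : ℚ :=
  (((a : ℚ) + 2 * m + 2 * (t + r) + 4) / (m + 1 + t) + m / (a + (t + r) + 2)) /
    ((t.factorial : ℚ) * ((r + 1).factorial : ℚ))

/-- The part of the associativity summands that is common to the two sides. -/
noncomputable def commonPart (a m t r : ℕ) : ℚ :=
  (2 * (a : ℚ) + m + 2 * (t + r) + 4) / (a + (t + r) + 2) * (1 - a / (a + 1 + t)) /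
    (((t + 1).factorial : ℚ) * (r.factorial : ℚ))

theorem D_mul_D_one_left (a m t r : ℕ) :
    D (a + 1) (m + 1) t * D 1 (a + m + 2 + t) r =
      (-1) ^ (t + r) * ((a + m + (t + r) + 1).factorial : ℚ) /
          ((a.factorial : ℚ) * (m.factorial : ℚ)) *
        (reflectedPart a m t r + commonPart a m t r) := by
  have h₁ : a + 1 + (m + 1) + t - 1 = a + m + t + 1 := by omega
  have h₂ : 1 + (a + m + 2 + t) + r - 1 = a + m + (t + r) + 1 + 1 := by omega
  have h₃ : a + m + 2 + t - 1 = a + m + t + 1 := by omega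
  simp only [D, reflectedPart, commonPart, h₁, h₂, h₃, Nat.add_sub_cancel, Nat.sub_self,
    Nat.factorial_zero, Nat.factorial_succ (a + m + (t + r) + 1), Nat.factorial_succ t,
    Nat.factorial_succ r]
  have := Nat.cast_ne_zero (R := ℚ).2 (a + m + t + 1).factorial_ne_zero
  have := Nat.cast_ne_zero (R := ℚ).2 a.factorial_ne_zero
  have := Nat.cast_ne_zero (R := ℚ).2 m.factorial_ne_zero
  have := Nat.cast_ne_zero (R := ℚ).2 t.factorial_ne_zero
  have := Nat.cast_ne_zero (R := ℚ).2 r.factorial_ne_zero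
  push_cast
  field_simp
  ring

theorem D_one_mul_D_left (a m t r : ℕ) :
    D 1 (a + 1) t * D (a + 2 + t) (m + 1) r =
      (-1) ^ (t + r) * ((a + m + (t + r) + 1).factorial : ℚ) /
          ((a.factorial : ℚ) * (m.factorial : ℚ)) *
        (reflectedPart a m r t + commonPart a m t r) := by
  have h₁ : 1 + (a + 1) + t - 1 = a + t + 1 := by omega
  have h₂ : a + 2 + t + (m + 1) + r - 1 = a + m + (t + r) + 1 + 1 := by omega
  have h₃ : a + 2 + t - 1 = a + t + 1 := by omega
  simp only [D, reflectedPart, commonPart, h₁, h₂, h₃, Nat.add_sub_cancel, Nat.sub_self,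
    Nat.factorial_zero, Nat.factorial_succ (a + m + (t + r) + 1), Nat.factorial_succ t]
  have := Nat.cast_ne_zero (R := ℚ).2 (a + t + 1).factorial_ne_zero
  have := Nat.cast_ne_zero (R := ℚ).2 a.factorial_ne_zero
  have := Nat.cast_ne_zero (R := ℚ).2 m.factorial_ne_zero
  have := Nat.cast_ne_zero (R := ℚ).2 t.factorial_ne_zero
  have := Nat.cast_ne_zero (R := ℚ).2 r.factorial_ne_zero
  push_cast
  field_simp
  ring

theorem sum_antidiagonal_D_mul_D (a m k : ℕ) :
    ∑ p ∈ antidiagonal k, D (a + 1) (m + 1) p.1 * D 1 (a + m + 2 + p.1) p.2 =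
      ∑ p ∈ antidiagonal k, D 1 (a + 1) p.1 * D (a + 2 + p.1) (m + 1) p.2 := by
  have hL : ∀ p ∈ antidiagonal k, D (a + 1) (m + 1) p.1 * D 1 (a + m + 2 + p.1) p.2 =
      (-1) ^ k * ((a + m + k + 1).factorial : ℚ) / ((a.factorial : ℚ) * (m.factorial : ℚ)) *
        (reflectedPart a m p.1 p.2 + commonPart a m p.1 p.2) := fun p hp ↦ by
    rw [D_mul_D_one_left, mem_antidiagonal.1 hp]
  have hR : ∀ p ∈ antidiagonal k, D 1 (a + 1) p.1 * D (a + 2 + p.1) (m + 1) p.2 =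
      (-1) ^ k * ((a + m + k + 1).factorial : ℚ) / ((a.factorial : ℚ) * (m.factorial : ℚ)) *
        (reflectedPart a m p.2 p.1 + commonPart a m p.1 p.2) := fun p hp ↦ by
    rw [D_one_mul_D_left, mem_antidiagonal.1 hp]
  rw [sum_congr rfl hL, sum_congr rfl hR, ← mul_sum, ← mul_sum, sum_add_distrib,
    sum_add_distrib, ← Nat.sum_antidiagonal_swap (f := fun p ↦ reflectedPart a m p.1 p.2)]
  rfl

theorem sum_Icc_eq_sum_antidiagonal (f : ℕ → ℚ) (b k : ℕ) :
    ∑ i ∈ Icc b (b + k), f i = ∑ p ∈ antidiagonal k, f (b + p.1) := by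
  rw [Nat.sum_antidiagonal_eq_sum_range_succ_mk, ← Ico_add_one_right_eq_Icc,
    sum_Ico_eq_sum_range, show b + k + 1 - b = k.succ by omega]

/-- The closed-form structure constants satisfy the associativity relation obtained by
comparing `𝒪¹·(𝒪^{n−1}·𝒪^m)` with `(𝒪¹·𝒪^{n−1})·𝒪^m`. -/
theorem stmt3 (n m k : ℕ) (hn : 2 ≤ n) (hm : 1 ≤ m) :
    ∑ i ∈ Icc (n + m - 1) (n + m + k - 1), D (n - 1) m (i + 1 - n - m) * D 1 i (n + m + k - 1 - i)
      = ∑ j ∈ Icc n (n + k), D 1 (n - 1) (j - n) * D j m (n + k - j) := by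
  obtain ⟨a, rfl⟩ := Nat.exists_eq_add_of_le' hn
  obtain ⟨m, rfl⟩ := Nat.exists_eq_add_of_le' hm
  rw [show a + 2 + (m + 1) - 1 = a + m + 2 by omega,
    show a + 2 + (m + 1) + k - 1 = a + m + 2 + k by omega, show a + 2 - 1 = a + 1 by omega,
    sum_Icc_eq_sum_antidiagonal, sum_Icc_eq_sum_antidiagonal]
  convert sum_antidiagonal_D_mul_D a m k using 2 with p hp p hp
  · have := mem_antidiagonal.1 hp
    congr 2 <;> omega
  · have := mem_antidiagonal.1 hp
    congr 2 <;> omega
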